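/- arXiv:2101.04955 — 2 statements merged into one kernel-verified Lean document; each statement's English description precedes it below -/
import Mathlib

section
/- For every integer k ≥ 0 there is a constant C_k > 0 (depending on P and k) such that |∂_θ^k P(θ,τ)| ≤ C_k (1 + τ) for all θ ∈ ℝ and all τ ≥ 0; i.e., P grows at most linearly in τ in every C^k norm. -/
open Real

/-- The directional derivative of `F` along the fixed vector `v`. -/
noncomputable def dirDeriv (v : ℝ × ℝ) (F : ℝ × ℝ → ℝ) (p : ℝ × ℝ) : ℝ := fderiv ℝ F p v

lemma ContDiff.dirDeriv {F : ℝ × ℝ → ℝ} (hF : ContDiff ℝ (⊤ : ℕ∞) F) (v : ℝ × ℝ) :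
    ContDiff ℝ (⊤ : ℕ∞) (dirDeriv v F) :=
  (hF.fderiv_right (m := (⊤ : ℕ∞)) (by simp)).clm_apply contDiff_const

lemma dirDeriv_comm {F : ℝ × ℝ → ℝ} (hF : ContDiff ℝ (⊤ : ℕ∞) F) (v w : ℝ × ℝ) :
    dirDeriv v (dirDeriv w F) = dirDeriv w (dirDeriv v F) := by
  have hd : Differentiable ℝ (fderiv ℝ F) :=
    (hF.fderiv_right (m := (⊤ : ℕ∞)) (by simp)).differentiable (by simp)
  have key : ∀ (a b p : ℝ × ℝ),
      dirDeriv a (dirDeriv b F) p = fderiv ℝ (fderiv ℝ F) p a b := by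
    intro a b p
    have h := (hd p).hasFDerivAt.clm_apply (hasFDerivAt_const b p)
    have h' : fderiv ℝ (dirDeriv b F) p = _ := h.fderiv
    simp [dirDeriv, h']
  ext p
  rw [key, key]
  have hs : IsSymmSndFDerivAt ℝ F p := (hF.contDiffAt).isSymmSndFDerivAt (by
    rw [minSmoothness_of_isRCLikeNormedField]
    exact WithTop.coe_le_coe.2 (le_top (a := (2 : ℕ∞))))
  exact hs v w

lemma hasDerivAt_fst_slice {F : ℝ × ℝ → ℝ} (hF : ContDiff ℝ (⊤ : ℕ∞) F) (θ τ : ℝ) :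
    HasDerivAt (fun s => F (s, τ)) (dirDeriv (1, 0) F (θ, τ)) θ :=
  ((hF.differentiable (by simp)) (θ, τ)).hasFDerivAt.comp_hasDerivAt θ
    ((hasDerivAt_id θ).prodMk (hasDerivAt_const θ τ))

lemma hasDerivAt_snd_slice {F : ℝ × ℝ → ℝ} (hF : ContDiff ℝ (⊤ : ℕ∞) F) (θ τ : ℝ) :
    HasDerivAt (fun t => F (θ, t)) (dirDeriv (0, 1) F (θ, τ)) τ :=
  ((hF.differentiable (by simp)) (θ, τ)).hasFDerivAt.comp_hasDerivAt τ
    ((hasDerivAt_const τ θ).prodMk (hasDerivAt_id τ))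

lemma contDiff_iterate_dirDeriv {F : ℝ × ℝ → ℝ} (hF : ContDiff ℝ (⊤ : ℕ∞) F) (v : ℝ × ℝ) (k : ℕ) :
    ContDiff ℝ (⊤ : ℕ∞) ((dirDeriv v)^[k] F) := by
  induction k with
  | zero => exact hF
  | succ k ih => rw [Function.iterate_succ_apply']; exact ih.dirDeriv v

lemma iteratedDeriv_fst_slice {F : ℝ × ℝ → ℝ} (hF : ContDiff ℝ (⊤ : ℕ∞) F) (k : ℕ) (θ τ : ℝ) :
    iteratedDeriv k (fun s => F (s, τ)) θ = (dirDeriv (1, 0))^[k] F (θ, τ) := by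
  induction k generalizing θ with
  | zero => simp
  | succ k ih =>
    rw [iteratedDeriv_succ, funext ih, Function.iterate_succ_apply']
    exact (hasDerivAt_fst_slice (contDiff_iterate_dirDeriv hF _ k) θ τ).deriv

lemma iteratedDeriv_snd_slice {F : ℝ × ℝ → ℝ} (hF : ContDiff ℝ (⊤ : ℕ∞) F) (k : ℕ) (θ τ : ℝ) :
    iteratedDeriv k (fun t => F (θ, t)) τ = (dirDeriv (0, 1))^[k] F (θ, τ) := by
  induction k generalizing τ with
  | zero => simp
  | succ k ih =>
    rw [iteratedDeriv_succ, funext ih, Function.iterate_succ_apply']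
    exact (hasDerivAt_snd_slice (contDiff_iterate_dirDeriv hF _ k) θ τ).deriv

/-- Smooth solutions of the polarised Gowdy equation, periodic in the first variable. -/
structure IsGowdySolution (F : ℝ × ℝ → ℝ) : Prop where
  smooth : ContDiff ℝ (⊤ : ℕ∞) F
  periodic : ∀ θ τ : ℝ, F (θ + 2 * π, τ) = F (θ, τ)
  eqn : ∀ θ τ : ℝ, 0 ≤ τ → dirDeriv (0, 1) (dirDeriv (0, 1) F) (θ, τ) =
    Real.exp (-2 * τ) * dirDeriv (1, 0) (dirDeriv (1, 0) F) (θ, τ)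

lemma dirDeriv_periodic {F : ℝ × ℝ → ℝ} (hper : ∀ θ τ : ℝ, F (θ + 2 * π, τ) = F (θ, τ))
    (v : ℝ × ℝ) (θ τ : ℝ) : dirDeriv v F (θ + 2 * π, τ) = dirDeriv v F (θ, τ) := by
  have h : (fun p : ℝ × ℝ => F (p + (2 * π, 0))) = F := by
    ext ⟨a, b⟩
    simpa using hper a b
  have h2 := fderiv_comp_add_right (𝕜 := ℝ) (f := F) (x := (θ, τ)) (2 * π, 0)
  rw [h] at h2
  simp only [dirDeriv, h2, Prod.mk_add_mk, add_zero]

lemma IsGowdySolution.dirDeriv_fst {F : ℝ × ℝ → ℝ} (h : IsGowdySolution F) :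
    IsGowdySolution (dirDeriv (1, 0) F) where
  smooth := h.smooth.dirDeriv _
  periodic := dirDeriv_periodic h.periodic _
  eqn θ τ hτ := by
    rw [dirDeriv_comm h.smooth, dirDeriv_comm (h.smooth.dirDeriv _)]
    have h1 := hasDerivAt_fst_slice ((h.smooth.dirDeriv (0, 1)).dirDeriv (0, 1)) θ τ
    have h2 := (hasDerivAt_fst_slice ((h.smooth.dirDeriv (1, 0)).dirDeriv (1, 0)) θ τ).const_mul
      (Real.exp (-2 * τ))
    rw [funext fun s => h.eqn s τ hτ] at h1
    exact h1.unique h2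

lemma IsGowdySolution.neg {F : ℝ × ℝ → ℝ} (h : IsGowdySolution F) :
    IsGowdySolution (-F) where
  smooth := h.smooth.neg
  periodic θ τ := by simp [h.periodic θ τ]
  eqn θ τ hτ := by
    have hn (v : ℝ × ℝ) (G : ℝ × ℝ → ℝ) : dirDeriv v (-G) = -dirDeriv v G := by
      ext p
      simp [dirDeriv, fderiv_neg]
    simp [hn, h.eqn θ τ hτ]

/-- The derivative of `F` along the null direction selected by the sign `s`. -/
noncomputable def nullDeriv (F : ℝ × ℝ → ℝ) (s θ τ : ℝ) : ℝ :=
  dirDeriv (0, 1) F (θ, τ) + s * (Real.exp (-τ) * dirDeriv (1, 0) F (θ, τ))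

lemma nullDeriv_continuous {F : ℝ × ℝ → ℝ} (hF : ContDiff ℝ (⊤ : ℕ∞) F) :
    Continuous fun q : ℝ × ℝ × ℝ => nullDeriv F q.1 q.2.1 q.2.2 := by
  have h1 := (hF.dirDeriv (0, 1)).continuous
  have h2 := (hF.dirDeriv (1, 0)).continuous
  unfold nullDeriv
  fun_prop

lemma nullDeriv_periodic {F : ℝ × ℝ → ℝ} (hper : ∀ θ τ : ℝ, F (θ + 2 * π, τ) = F (θ, τ))
    (s τ : ℝ) : Function.Periodic (fun θ => nullDeriv F s θ τ) (2 * π) := by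
  intro θ
  simp only [nullDeriv, dirDeriv_periodic hper]

lemma HasDerivAt.nonneg_of_le_left {f : ℝ → ℝ} {f' a b : ℝ} (hf : HasDerivAt f f' b) (hab : a < b)
    (hle : ∀ t ∈ Set.Ioo a b, f t ≤ f b) : 0 ≤ f' := by
  have h := hasDerivWithinAt_iff_tendsto_slope.1 (hf.hasDerivWithinAt (s := Set.Iio b))
  rw [Set.sdiff_singleton_eq_self (by simp)] at h
  refine ge_of_tendsto h ?_
  filter_upwards [Ioo_mem_nhdsLT hab] with t ht
  rw [slope_def_field]
  exact div_nonneg_of_nonpos (by linarith [hle t ht]) (by linarith [ht.2])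

/-- At a spatial maximum over both null directions, the null derivative does not increase. -/
lemma IsGowdySolution.exists_hasDerivAt_nullDeriv_nonpos {F : ℝ × ℝ → ℝ} (h : IsGowdySolution F)
    {s θ τ : ℝ} (hs : s * s = 1) (hτ : 0 ≤ τ)
    (hmax : ∀ x, nullDeriv F s x τ ≤ nullDeriv F s θ τ)
    (hmax' : nullDeriv F (-s) θ τ ≤ nullDeriv F s θ τ) :
    ∃ d ≤ 0, HasDerivAt (fun t => nullDeriv F s θ t) d τ := by
  have hθ : HasDerivAt (fun x => nullDeriv F s x τ)
      (dirDeriv (1, 0) (dirDeriv (0, 1) F) (θ, τ) +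
        s * (Real.exp (-τ) * dirDeriv (1, 0) (dirDeriv (1, 0) F) (θ, τ))) θ :=
    (hasDerivAt_fst_slice (h.smooth.dirDeriv (0, 1)) θ τ).add
      (((hasDerivAt_fst_slice (h.smooth.dirDeriv (1, 0)) θ τ).const_mul _).const_mul s)
  have hzero := IsLocalMax.hasDerivAt_eq_zero (Filter.Eventually.of_forall hmax) hθ
  have he : HasDerivAt (fun t : ℝ => Real.exp (-t)) (Real.exp (-τ) * -1) τ :=
    (hasDerivAt_neg τ).exp
  refine ⟨_, ?_, (hasDerivAt_snd_slice (h.smooth.dirDeriv (0, 1)) θ τ).add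
    ((he.mul (hasDerivAt_snd_slice (h.smooth.dirDeriv (1, 0)) θ τ)).const_mul s)⟩
  rw [h.eqn θ τ hτ, dirDeriv_comm h.smooth (0, 1) (1, 0)]
  have hexp : Real.exp (-2 * τ) = Real.exp (-τ) * Real.exp (-τ) := by
    rw [← Real.exp_add]; ring_nf
  rw [hexp]
  simp only [nullDeriv] at hmax'
  generalize dirDeriv (1, 0) (dirDeriv (0, 1) F) (θ, τ) = a at *
  generalize dirDeriv (1, 0) (dirDeriv (1, 0) F) (θ, τ) = b at *
  generalize dirDeriv (1, 0) F (θ, τ) = c at *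
  generalize Real.exp (-τ) = e at *
  have hid : e * e * b + s * (e * -1 * c + e * a) = -(s * (e * c)) := by
    linear_combination s * e * hzero - e * e * b * hs
  linarith

/-- Maximum principle: bounds on both null derivatives at time zero persist. -/
lemma IsGowdySolution.nullDeriv_le {F : ℝ × ℝ → ℝ} (h : IsGowdySolution F) {M : ℝ}
    (h0 : ∀ s ∈ ({1, -1} : Set ℝ), ∀ θ, nullDeriv F s θ 0 ≤ M) {s : ℝ}
    (hs : s ∈ ({1, -1} : Set ℝ)) (θ : ℝ) {τ : ℝ} (hτ : 0 ≤ τ) : nullDeriv F s θ τ ≤ M := by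
  suffices hε : ∀ ε > 0, nullDeriv F s θ τ - ε * τ ≤ M by
    refine le_of_forall_pos_le_add fun δ hδ => ?_
    have h1 := hε (δ / (τ + 1)) (by positivity)
    have h2 : δ / (τ + 1) * τ ≤ δ := by
      rw [div_mul_eq_mul_div, div_le_iff₀ (by positivity)]
      nlinarith
    linarith
  intro ε hε
  have hcont : Continuous fun q : ℝ × ℝ × ℝ => nullDeriv F q.1 q.2.1 q.2.2 - ε * q.2.2 :=
    (nullDeriv_continuous h.smooth).sub (by fun_prop)
  have hcompact : IsCompact (({1, -1} : Set ℝ) ×ˢ Set.Icc 0 (2 * π) ×ˢ Set.Icc 0 τ) :=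
    (Set.toFinite _).isCompact.prod (isCompact_Icc.prod isCompact_Icc)
  obtain ⟨⟨s₀, θ₀, τ₀⟩, ⟨hs₀, -, hτ₀⟩, hmax⟩ := hcompact.exists_isMaxOn
    ⟨(s, 0, τ), hs, ⟨le_rfl, by positivity⟩, hτ, le_rfl⟩ hcont.continuousOn
  simp only at hs₀ hτ₀
  have hmax : ∀ s ∈ ({1, -1} : Set ℝ), ∀ x, ∀ t ∈ Set.Icc 0 τ,
      nullDeriv F s x t - ε * t ≤ nullDeriv F s₀ θ₀ τ₀ - ε * τ₀ := by
    intro s hs x t ht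
    obtain ⟨y, hy, hxy⟩ := (nullDeriv_periodic h.periodic s t).exists_mem_Ico₀ (by positivity) x
    rw [hxy]
    exact hmax (a := (s, y, t)) ⟨hs, Set.Ico_subset_Icc_self hy, ht⟩
  refine (hmax s hs θ τ ⟨hτ, le_rfl⟩).trans ?_
  rcases hτ₀.1.eq_or_lt with h00 | hpos
  · simpa [← h00] using h0 s₀ hs₀ θ₀
  exfalso
  have hsq : s₀ * s₀ = 1 ∧ -s₀ ∈ ({1, -1} : Set ℝ) := by
    rcases hs₀ with rfl | rfl <;> simp
  obtain ⟨d, hd, hderiv⟩ := h.exists_hasDerivAt_nullDeriv_nonpos hsq.1 hτ₀.1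
    (fun x => by simpa using hmax s₀ hs₀ x τ₀ hτ₀)
    (by simpa using hmax (-s₀) hsq.2 θ₀ τ₀ hτ₀)
  have hderiv' := hderiv.sub ((hasDerivAt_id τ₀).const_mul ε)
  have := hderiv'.nonneg_of_le_left hpos fun t ht =>
    hmax s₀ hs₀ θ₀ t ⟨ht.1.le, ht.2.le.trans hτ₀.2⟩
  linarith

lemma IsGowdySolution.exists_dirDeriv_snd_le {F : ℝ × ℝ → ℝ} (h : IsGowdySolution F) :
    ∃ M : ℝ, ∀ θ τ : ℝ, 0 ≤ τ → dirDeriv (0, 1) F (θ, τ) ≤ M := by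
  have hcompact : IsCompact (({1, -1} : Set ℝ) ×ˢ Set.Icc 0 (2 * π) ×ˢ ({0} : Set ℝ)) :=
    (Set.toFinite _).isCompact.prod (isCompact_Icc.prod isCompact_singleton)
  obtain ⟨M, hM⟩ := hcompact.bddAbove_image (nullDeriv_continuous h.smooth).continuousOn
  have h0 : ∀ s ∈ ({1, -1} : Set ℝ), ∀ θ, nullDeriv F s θ 0 ≤ M := by
    intro s hs θ
    obtain ⟨y, hy, hxy⟩ := (nullDeriv_periodic h.periodic s 0).exists_mem_Ico₀ (by positivity) θ
    rw [hxy]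
    exact hM ⟨(s, y, 0), ⟨hs, Set.Ico_subset_Icc_self hy, rfl⟩, rfl⟩
  refine ⟨M, fun θ τ hτ => ?_⟩
  have h1 := h.nullDeriv_le h0 (s := 1) (by simp) θ hτ
  have h2 := h.nullDeriv_le h0 (s := -1) (by simp) θ hτ
  simp only [nullDeriv] at h1 h2
  linarith

lemma IsGowdySolution.exists_le {F : ℝ × ℝ → ℝ} (h : IsGowdySolution F) :
    ∃ C : ℝ, 0 < C ∧ ∀ θ τ : ℝ, 0 ≤ τ → F (θ, τ) ≤ C * (1 + τ) := by
  obtain ⟨M, hM⟩ := h.exists_dirDeriv_snd_le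
  have hc : Continuous fun θ : ℝ => F (θ, 0) := h.smooth.continuous.comp (by fun_prop)
  obtain ⟨B, hB⟩ := (isCompact_Icc (a := (0 : ℝ)) (b := 2 * π)).bddAbove_image hc.continuousOn
  refine ⟨|M| + |B| + 1, by positivity, fun θ τ hτ => ?_⟩
  have hF0 : F (θ, 0) ≤ B := by
    have hp : Function.Periodic (fun θ => F (θ, 0)) (2 * π) := fun θ => h.periodic θ 0
    obtain ⟨y, hy, hxy⟩ := hp.exists_mem_Ico₀ (by positivity) θ
    rw [hxy]
    exact hB ⟨y, Set.Ico_subset_Icc_self hy, rfl⟩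
  have hdiff : Differentiable ℝ fun t => F (θ, t) := fun t =>
    (hasDerivAt_snd_slice h.smooth θ t).differentiableAt
  have hmv := (convex_Ici (0 : ℝ)).image_sub_le_mul_sub_of_deriv_le hdiff.continuous.continuousOn
    hdiff.differentiableOn (C := M) (fun t ht => by
      rw [(hasDerivAt_snd_slice h.smooth θ t).deriv]
      exact hM θ t (interior_subset ht)) 0 (by simp) τ hτ hτ
  have := mul_le_mul_of_nonneg_right (le_abs_self M) hτ
  have := mul_nonneg (abs_nonneg B) hτ
  have := le_abs_self B
  have := abs_nonneg M
  nlinarith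

lemma IsGowdySolution.exists_abs_le {F : ℝ × ℝ → ℝ} (h : IsGowdySolution F) :
    ∃ C : ℝ, 0 < C ∧ ∀ θ τ : ℝ, 0 ≤ τ → |F (θ, τ)| ≤ C * (1 + τ) := by
  obtain ⟨C₁, hC₁, h₁⟩ := h.exists_le
  obtain ⟨C₂, hC₂, h₂⟩ := h.neg.exists_le
  refine ⟨C₁ + C₂, by positivity, fun θ τ hτ => abs_le'.2 ⟨?_, ?_⟩⟩
  · nlinarith [h₁ θ τ hτ]
  · have := h₂ θ τ hτ
    simp only [Pi.neg_apply] at this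
    nlinarith

open Real

/-- Polarised T³-Gowdy: if `P` is smooth, `2π`-periodic in `θ`, and satisfies
`∂_τ² P = e^{-2τ} ∂_θ² P` for `τ ≥ 0`, then for every `k ≥ 0` there is a constant
`C_k > 0` such that `|∂_θ^k P(θ,τ)| ≤ C_k (1 + τ)` for all `θ ∈ ℝ` and all `τ ≥ 0`;
i.e. `P` grows at most linearly in every `C^k` norm. -/
theorem gowdy_P_linear_growth (P : ℝ → ℝ → ℝ)
    (hP : ContDiff ℝ (⊤ : ℕ∞) (fun p : ℝ × ℝ => P p.1 p.2))
    (hper : ∀ θ τ : ℝ, P (θ + 2 * π) τ = P θ τ)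
    (heq : ∀ θ τ : ℝ, 0 ≤ τ →
      iteratedDeriv 2 (fun t => P θ t) τ =
        Real.exp (-2 * τ) * iteratedDeriv 2 (fun s => P s τ) θ) :
    ∀ k : ℕ, ∃ C : ℝ, 0 < C ∧ ∀ θ τ : ℝ, 0 ≤ τ →
      |iteratedDeriv k (fun s => P s τ) θ| ≤ C * (1 + τ) := by
  intro k
  have hsol : IsGowdySolution (fun p : ℝ × ℝ => P p.1 p.2) :=
    { smooth := hP
      periodic := hper
      eqn := fun θ τ hτ => by
        have h := heq θ τ hτ
        have h1 := iteratedDeriv_fst_slice hP 2 θ τ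
        have h2 := iteratedDeriv_snd_slice hP 2 θ τ
        simp only at h1 h2
        rw [h1, h2] at h
        exact h }
  have hk : IsGowdySolution ((dirDeriv (1, 0))^[k] fun p : ℝ × ℝ => P p.1 p.2) := by
    induction k with
    | zero => exact hsol
    | succ k ih => rw [Function.iterate_succ_apply']; exact ih.dirDeriv_fst
  obtain ⟨C, hC, hb⟩ := hk.exists_abs_le
  refine ⟨C, hC, fun θ τ hτ => ?_⟩
  have h1 := iteratedDeriv_fst_slice hP k θ τ
  simp only at h1
  rw [h1]
  exact hb θ τ hτ
end

section
/- There exists a smooth 2π-periodic function v : ℝ → ℝ such that for every integer k ≥ 0 there is a constant C_k > 0 with |∂_θ^k ( ∂_τ P(θ,τ) − v(θ) )| ≤ C_k (1 + τ) e^{−2τ} for all θ ∈ ℝ and all τ ≥ 0; i.e., ∂_τ P converges exponentially to a smooth limit (the asymptotic velocity) in every C^k norm. -/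
open Real

open Filter Topology Set

/-- The partial derivative in the first variable. -/
noncomputable def partialFst (F : ℝ × ℝ → ℝ) (p : ℝ × ℝ) : ℝ := fderiv ℝ F p (1, 0)

/-- The partial derivative in the second variable. -/
noncomputable def partialSnd (F : ℝ × ℝ → ℝ) (p : ℝ × ℝ) : ℝ := fderiv ℝ F p (0, 1)

theorem hasDerivAt_partialFst {F : ℝ × ℝ → ℝ} (hF : Differentiable ℝ F) (x t : ℝ) :
    HasDerivAt (fun s => F (s, t)) (partialFst F (x, t)) x :=
  (hF (x, t)).hasFDerivAt.comp_hasDerivAt x ((hasDerivAt_id x).prodMk (hasDerivAt_const x t))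

theorem hasDerivAt_partialSnd {F : ℝ × ℝ → ℝ} (hF : Differentiable ℝ F) (x t : ℝ) :
    HasDerivAt (fun s => F (x, s)) (partialSnd F (x, t)) t :=
  (hF (x, t)).hasFDerivAt.comp_hasDerivAt t ((hasDerivAt_const t x).prodMk (hasDerivAt_id t))

theorem ContDiff.partialFst {F : ℝ × ℝ → ℝ} (hF : ContDiff ℝ (⊤ : ℕ∞) F) :
    ContDiff ℝ (⊤ : ℕ∞) (partialFst F) :=
  (hF.fderiv_right (m := (⊤ : ℕ∞)) (by simp)).clm_apply contDiff_const

theorem ContDiff.partialSnd {F : ℝ × ℝ → ℝ} (hF : ContDiff ℝ (⊤ : ℕ∞) F) :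
    ContDiff ℝ (⊤ : ℕ∞) (partialSnd F) :=
  (hF.fderiv_right (m := (⊤ : ℕ∞)) (by simp)).clm_apply contDiff_const

theorem partialFst_partialSnd {F : ℝ × ℝ → ℝ} (hF : ContDiff ℝ (⊤ : ℕ∞) F) :
    partialFst (partialSnd F) = partialSnd (partialFst F) := by
  have hd : Differentiable ℝ (fderiv ℝ F) :=
    (hF.fderiv_right (m := (⊤ : ℕ∞)) (by simp)).differentiable (by simp)
  funext p
  have key : ∀ v w : ℝ × ℝ,
      fderiv ℝ (fun q => fderiv ℝ F q v) p w = fderiv ℝ (fderiv ℝ F) p w v := by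
    intro v w
    rw [fderiv_clm_apply (hd p) (differentiableAt_const v)]
    simp
  have hs : IsSymmSndFDerivAt ℝ F p :=
    hF.contDiffAt.isSymmSndFDerivAt (by simpa using WithTop.coe_le_coe.2 (le_top : (2 : ℕ∞) ≤ ⊤))
  change fderiv ℝ (fun q => fderiv ℝ F q (0, 1)) p (1, 0) =
    fderiv ℝ (fun q => fderiv ℝ F q (1, 0)) p (0, 1)
  rw [key, key]
  exact hs _ _

/-- A derivative is nonnegative at a point which is maximal over an interval to its left. -/
theorem HasDerivAt.nonneg_of_forall_le_left {h : ℝ → ℝ} {h' a t : ℝ} (hh : HasDerivAt h h' t)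
    (hat : a < t) (hle : ∀ s, a ≤ s → s ≤ t → h s ≤ h t) : 0 ≤ h' := by
  have h1 : Tendsto (slope h t) (𝓝[<] t) (𝓝 h') :=
    hh.tendsto_slope.mono_left (nhdsWithin_mono _ fun x hx => ne_of_lt hx)
  refine ge_of_tendsto h1 ?_
  filter_upwards [Ioo_mem_nhdsLT hat] with s hs
  rw [slope_def_field]
  exact div_nonneg_of_nonpos (by linarith [hle s hs.1.le hs.2.le]) (by linarith [hs.2])

theorem exists_bound_of_continuous_of_periodic {f : ℝ → ℝ} {c : ℝ} (hc : 0 < c)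
    (hf : Continuous f) (hp : ∀ x, f (x + c) = f x) : ∃ C, ∀ x, |f x| ≤ C := by
  obtain ⟨C, hC⟩ := isCompact_Icc.exists_bound_of_continuousOn (s := Icc 0 c) hf.continuousOn
  refine ⟨C, fun x => ?_⟩
  obtain ⟨y, hy, hxy⟩ := Function.Periodic.exists_mem_Ico₀ (f := f) hp hc x
  rw [hxy]
  exact hC y ⟨hy.1, hy.2.le⟩

/-- The maximum principle for a pair of transport equations with damped exchange. -/
theorem max_le_of_transport_pair {u w ux ut wx wt a b : ℝ × ℝ → ℝ} {c M : ℝ} (hc : 0 < c)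
    (hu : Continuous u) (hw : Continuous w)
    (hup : ∀ x t, u (x + c, t) = u (x, t)) (hwp : ∀ x t, w (x + c, t) = w (x, t))
    (hux : ∀ x t, HasDerivAt (fun s => u (s, t)) (ux (x, t)) x)
    (hut : ∀ x t, HasDerivAt (fun s => u (x, s)) (ut (x, t)) t)
    (hwx : ∀ x t, HasDerivAt (fun s => w (s, t)) (wx (x, t)) x)
    (hwt : ∀ x t, HasDerivAt (fun s => w (x, s)) (wt (x, t)) t)
    (hequ : ∀ p : ℝ × ℝ, 0 ≤ p.2 → ut p = a p * ux p - (u p - w p) / 2)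
    (heqw : ∀ p : ℝ × ℝ, 0 ≤ p.2 → wt p = b p * wx p + (u p - w p) / 2)
    (hM : ∀ x, max (u (x, 0)) (w (x, 0)) ≤ M) (x t : ℝ) (ht : 0 ≤ t) :
    max (u (x, t)) (w (x, t)) ≤ M := by
  have key : ∀ ε > 0, max (u (x, t)) (w (x, t)) - ε * t ≤ M := by
    intro ε hε
    set g : ℝ × ℝ → ℝ := fun p => max (u p) (w p) - ε * p.2 with hg
    have hgc : Continuous g := by fun_prop
    obtain ⟨⟨y, r⟩, hyr, hmax⟩ :=
      (isCompact_Icc (a := (0 : ℝ)) (b := c)).prod (isCompact_Icc (a := (0 : ℝ)) (b := t))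
        |>.exists_isMaxOn ⟨(0, 0), ⟨⟨le_rfl, hc.le⟩, ⟨le_rfl, ht⟩⟩⟩ hgc.continuousOn
    have hall : ∀ z s, 0 ≤ s → s ≤ t → g (z, s) ≤ g (y, r) := by
      intro z s hs hst
      obtain ⟨z', hz', hzz⟩ := Function.Periodic.exists_mem_Ico₀ (f := fun z => g (z, s))
        (fun z => by simp only [hg, hup, hwp]) hc z
      rw [hzz]
      exact hmax ⟨⟨hz'.1, hz'.2.le⟩, ⟨hs, hst⟩⟩
    have hr0 : 0 ≤ r := hyr.2.1
    have hrt : r ≤ t := hyr.2.2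
    have hr : r = 0 := by
      by_contra hne
      have hrpos : 0 < r := lt_of_le_of_ne hr0 (Ne.symm hne)
      rcases le_total (w (y, r)) (u (y, r)) with hle | hle
      · have hgv : g (y, r) = u (y, r) - ε * r := by simp [hg, hle]
        have hb : ∀ z s, 0 ≤ s → s ≤ t → u (z, s) - ε * s ≤ u (y, r) - ε * r := by
          intro z s hs hst
          have h1 := hall z s hs hst
          have h2 := le_max_left (u (z, s)) (w (z, s))
          rw [hgv] at h1
          simp only [hg] at h1
          linarith
        have h0 : ux (y, r) = 0 :=
          IsLocalMax.hasDerivAt_eq_zero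
            (Eventually.of_forall fun z => by simpa using hb z r hr0 hrt) (hux y r)
        have h1 := ((hut y r).sub ((hasDerivAt_id r).const_mul ε)).nonneg_of_forall_le_left hrpos
          (fun s hs hsr => hb y s hs (hsr.trans hrt))
        rw [hequ _ hr0, h0] at h1
        linarith
      · have hgv : g (y, r) = w (y, r) - ε * r := by simp [hg, hle]
        have hb : ∀ z s, 0 ≤ s → s ≤ t → w (z, s) - ε * s ≤ w (y, r) - ε * r := by
          intro z s hs hst
          have h1 := hall z s hs hst
          have h2 := le_max_right (u (z, s)) (w (z, s))
          rw [hgv] at h1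
          simp only [hg] at h1
          linarith
        have h0 : wx (y, r) = 0 :=
          IsLocalMax.hasDerivAt_eq_zero
            (Eventually.of_forall fun z => by simpa using hb z r hr0 hrt) (hwx y r)
        have h1 := ((hwt y r).sub ((hasDerivAt_id r).const_mul ε)).nonneg_of_forall_le_left hrpos
          (fun s hs hsr => hb y s hs (hsr.trans hrt))
        rw [heqw _ hr0, h0] at h1
        linarith
    subst hr
    have h1 := hall x t ht le_rfl
    simp only [hg, mul_zero, sub_zero] at h1
    exact h1.trans (hM y)
  by_contra! hlt
  have h1 := key ((max (u (x, t)) (w (x, t)) - M) / (2 * (t + 1))) (by apply div_pos <;> linarith)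
  have h2 : (max (u (x, t)) (w (x, t)) - M) / (2 * (t + 1)) * t ≤
      (max (u (x, t)) (w (x, t)) - M) / 2 := by
    rw [div_mul_eq_mul_div, div_le_div_iff₀ (by linarith) (by norm_num)]
    nlinarith
  linarith

/-- Smooth, `2π`-periodic solutions of the polarised Gowdy equation on `τ ≥ 0`. -/
structure IsGowdySolution_s14 (F : ℝ × ℝ → ℝ) : Prop where
  contDiff : ContDiff ℝ (⊤ : ℕ∞) F
  periodic : ∀ x t, F (x + 2 * π, t) = F (x, t)
  eq : ∀ x t, 0 ≤ t →
    partialSnd (partialSnd F) (x, t) = exp (-2 * t) * partialFst (partialFst F) (x, t)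

theorem partialFst_periodic {F : ℝ × ℝ → ℝ} {c : ℝ} (hF : Differentiable ℝ F)
    (hp : ∀ x t, F (x + c, t) = F (x, t)) (x t : ℝ) :
    partialFst F (x + c, t) = partialFst F (x, t) := by
  have h1 := (hasDerivAt_partialFst hF (x + c) t).comp_add_const x c
  simp only [hp] at h1
  exact h1.unique (hasDerivAt_partialFst hF x t)

theorem partialSnd_periodic {F : ℝ × ℝ → ℝ} {c : ℝ} (hF : Differentiable ℝ F)
    (hp : ∀ x t, F (x + c, t) = F (x, t)) (x t : ℝ) :
    partialSnd F (x + c, t) = partialSnd F (x, t) := by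
  have h1 := hasDerivAt_partialSnd hF (x + c) t
  simp only [hp] at h1
  exact h1.unique (hasDerivAt_partialSnd hF x t)

namespace IsGowdySolution_s14

variable {F : ℝ × ℝ → ℝ}

theorem differentiable (h : IsGowdySolution_s14 F) : Differentiable ℝ F :=
  h.contDiff.differentiable (by simp)

protected theorem partialFst (h : IsGowdySolution_s14 F) : IsGowdySolution_s14 (partialFst F) where
  contDiff := h.contDiff.partialFst
  periodic := partialFst_periodic h.differentiable h.periodic
  eq x t ht := by
    have hc := h.contDiff
    rw [← partialFst_partialSnd hc, ← partialFst_partialSnd hc.partialSnd]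
    have h1 := hasDerivAt_partialFst (hc.partialSnd.partialSnd.differentiable (by simp)) x t
    have h2 := (hasDerivAt_partialFst
      (hc.partialFst.partialFst.differentiable (by simp)) x t).const_mul (exp (-2 * t))
    simp only [h.eq _ t ht] at h1
    exact h1.unique h2

theorem iterate_partialFst (h : IsGowdySolution_s14 F) (k : ℕ) :
    IsGowdySolution_s14 (partialFst^[k] F) := by
  induction k with
  | zero => exact h
  | succ k ih =>
    rw [Function.iterate_succ_apply']
    exact ih.partialFst

theorem exists_partialSnd_bound (h : IsGowdySolution_s14 F) :
    ∃ M, ∀ x t, 0 ≤ t → |partialSnd F (x, t)| ≤ M := by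
  have hc := h.contDiff
  have hd := h.differentiable
  have hdx := hc.partialFst.differentiable (by simp)
  have hdt := hc.partialSnd.differentiable (by simp)
  have hx := hc.partialFst.continuous
  have ht := hc.partialSnd.continuous
  have hpx := partialFst_periodic hd h.periodic
  have hpt := partialSnd_periodic hd h.periodic
  obtain ⟨A, hA⟩ := exists_bound_of_continuous_of_periodic (f := fun x => partialFst F (x, 0))
    two_pi_pos (by fun_prop) (fun x => hpx x 0)
  obtain ⟨B, hB⟩ := exists_bound_of_continuous_of_periodic (f := fun x => partialSnd F (x, 0))
    two_pi_pos (by fun_prop) (fun x => hpt x 0)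
  have hexp : ∀ t : ℝ, HasDerivAt (fun s => exp (-s)) (-exp (-t)) t := fun t => by
    simpa using (hasDerivAt_neg t).exp
  have hsq : ∀ t : ℝ, exp (-2 * t) = exp (-t) * exp (-t) := fun t => by
    rw [← exp_add]; ring_nf
  have hcomm := partialFst_partialSnd hc
  have upper : ∀ σ : ℝ, (σ = 1 ∨ σ = -1) → ∀ x t, 0 ≤ t →
      σ * partialSnd F (x, t) ≤ A + B := by
    intro σ hσ x t ht0
    have hmax := max_le_of_transport_pair
      (u := fun p => σ * (partialSnd F p + exp (-p.2) * partialFst F p))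
      (w := fun p => σ * (partialSnd F p - exp (-p.2) * partialFst F p))
      (ux := fun p => σ * (partialFst (partialSnd F) p +
        exp (-p.2) * partialFst (partialFst F) p))
      (wx := fun p => σ * (partialFst (partialSnd F) p -
        exp (-p.2) * partialFst (partialFst F) p))
      (ut := fun p => σ * (partialSnd (partialSnd F) p +
        (-exp (-p.2) * partialFst F p + exp (-p.2) * partialSnd (partialFst F) p)))
      (wt := fun p => σ * (partialSnd (partialSnd F) p -
        (-exp (-p.2) * partialFst F p + exp (-p.2) * partialSnd (partialFst F) p)))
      (a := fun p => exp (-p.2)) (b := fun p => -exp (-p.2)) (M := A + B)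
      two_pi_pos (by fun_prop) (by fun_prop)
      (fun x t => by simp only [hpx, hpt]) (fun x t => by simp only [hpx, hpt])
      (fun x t => ((hasDerivAt_partialFst hdt x t).fun_add
        ((hasDerivAt_partialFst hdx x t).const_mul (exp (-t)))).const_mul σ)
      (fun x t => ((hasDerivAt_partialSnd hdt x t).fun_add
        ((hexp t).fun_mul (hasDerivAt_partialSnd hdx x t))).const_mul σ)
      (fun x t => ((hasDerivAt_partialFst hdt x t).fun_sub
        ((hasDerivAt_partialFst hdx x t).const_mul (exp (-t)))).const_mul σ)
      (fun x t => ((hasDerivAt_partialSnd hdt x t).fun_sub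
        ((hexp t).fun_mul (hasDerivAt_partialSnd hdx x t))).const_mul σ)
      (fun p hp => by
        rw [h.eq p.1 p.2 hp, hcomm, hsq]; ring)
      (fun p hp => by
        rw [h.eq p.1 p.2 hp, hcomm, hsq]; ring)
      (fun x => by
        have h1 := abs_le.1 (hA x)
        have h2 := abs_le.1 (hB x)
        rcases hσ with rfl | rfl <;> simp only [neg_zero, exp_zero] <;>
          apply max_le <;> linarith)
      x t ht0
    have h1 := (le_max_left _ _).trans hmax
    have h2 := (le_max_right _ _).trans hmax
    linarith
  refine ⟨A + B, fun x t ht0 => abs_le.2 ⟨?_, ?_⟩⟩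
  · linarith [upper (-1) (Or.inr rfl) x t ht0]
  · linarith [upper 1 (Or.inl rfl) x t ht0]

theorem exists_linear_bound (h : IsGowdySolution_s14 F) :
    ∃ C, 0 < C ∧ ∀ x t, 0 ≤ t → |F (x, t)| ≤ C * (1 + t) := by
  have hcont := h.contDiff.continuous
  obtain ⟨M, hM⟩ := h.exists_partialSnd_bound
  obtain ⟨A, hA⟩ := exists_bound_of_continuous_of_periodic (f := fun x => F (x, 0))
    two_pi_pos (by fun_prop) (fun x => h.periodic x 0)
  have hA0 : 0 ≤ A := (abs_nonneg _).trans (hA 0)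
  have hM0 : 0 ≤ M := (abs_nonneg _).trans (hM 0 0 le_rfl)
  refine ⟨A + M + 1, by linarith, fun x t ht => ?_⟩
  have h1 := image_norm_le_of_norm_deriv_right_le_deriv_boundary (a := 0) (b := t)
    (f := fun s => F (x, s)) (f' := fun s => partialSnd F (x, s))
    (B := fun s => A + M * s) (B' := fun _ => M)
    (by fun_prop) (fun s _ => (hasDerivAt_partialSnd h.differentiable x s).hasDerivWithinAt)
    (by simpa using hA x)
    (fun s => by simpa using ((hasDerivAt_id s).const_mul M).const_add A)
    (fun s hs => hM x s hs.1) (right_mem_Icc.2 ht)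
  have h2 : |F (x, t)| ≤ A + M * t := h1
  nlinarith

theorem exists_partialSnd_sub_bound (h : IsGowdySolution_s14 F) :
    ∃ C, 0 < C ∧ ∀ x s t, 0 ≤ s → s ≤ t →
      |partialSnd F (x, t) - partialSnd F (x, s)| ≤ C * (1 + s) * exp (-2 * s) := by
  have hdt := h.contDiff.partialSnd.differentiable (by simp)
  have hcont := h.contDiff.partialSnd.continuous
  obtain ⟨C, hC, hb⟩ := h.partialFst.partialFst.exists_linear_bound
  refine ⟨C, hC, fun x s t hs hst => ?_⟩
  set H : ℝ → ℝ := fun r => ((1 + r) / 2 + 1 / 4) * exp (-2 * r) with hH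
  have hHd : ∀ r, HasDerivAt H (-((1 + r) * exp (-2 * r))) r := by
    intro r
    have h1 : HasDerivAt (fun r : ℝ => (1 + r) / 2 + 1 / 4) (1 / 2) r :=
      (((hasDerivAt_id r).const_add 1).div_const 2).add_const _
    have h2 : HasDerivAt (fun r : ℝ => exp (-2 * r)) (exp (-2 * r) * (-2 * 1)) r :=
      ((hasDerivAt_id r).const_mul (-2)).exp
    exact (h1.fun_mul h2).congr_deriv (by ring)
  have h1 := image_norm_le_of_norm_deriv_right_le_deriv_boundary (a := s) (b := t)
    (f := fun r => partialSnd F (x, r) - partialSnd F (x, s))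
    (f' := fun r => partialSnd (partialSnd F) (x, r))
    (B := fun r => C * (H s - H r)) (B' := fun r => C * ((1 + r) * exp (-2 * r)))
    (by fun_prop) (fun r _ => ((hasDerivAt_partialSnd hdt x r).sub_const _).hasDerivWithinAt)
    (by simp)
    (fun r => by simpa using ((hHd r).const_sub (H s)).const_mul C)
    (fun r hr => by
      have hr0 : 0 ≤ r := hs.trans hr.1
      rw [h.eq x r hr0, norm_mul, norm_eq_abs, norm_eq_abs, abs_exp]
      have := mul_le_mul_of_nonneg_left (hb x r hr0) (exp_pos (-2 * r)).le
      linarith)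
    (right_mem_Icc.2 hst)
  have h2 : |partialSnd F (x, t) - partialSnd F (x, s)| ≤ C * (H s - H t) := h1
  have h3 : 0 ≤ H t := by
    have : 0 ≤ t := hs.trans hst
    positivity
  have h4 : H s ≤ (1 + s) * exp (-2 * s) :=
    mul_le_mul_of_nonneg_right (by linarith) (exp_pos _).le
  rw [mul_assoc]
  exact h2.trans (mul_le_mul_of_nonneg_left (by linarith) hC.le)

end IsGowdySolution_s14

theorem one_add_mul_exp_neg_two_mul_le (t : ℝ) : (1 + t) * exp (-2 * t) ≤ exp (-t) := by
  have h1 : exp (-t) = exp t * exp (-2 * t) := by rw [← exp_add]; ring_nf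
  rw [h1]
  exact mul_le_mul_of_nonneg_right (by linarith [add_one_le_exp t]) (exp_pos _).le

theorem iteratedDeriv_eq_of_hasDerivAt_succ {g : ℕ → ℝ → ℝ}
    (hg : ∀ k x, HasDerivAt (g k) (g (k + 1) x) x) (k : ℕ) : iteratedDeriv k (g 0) = g k := by
  induction k with
  | zero => exact iteratedDeriv_zero
  | succ k ih =>
    rw [iteratedDeriv_succ, ih]
    exact funext fun x => (hg k x).deriv

theorem contDiff_of_hasDerivAt_succ {g : ℕ → ℝ → ℝ}
    (hg : ∀ k x, HasDerivAt (g k) (g (k + 1) x) x) : ContDiff ℝ (⊤ : ℕ∞) (g 0) := by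
  refine contDiff_of_differentiable_iteratedDeriv fun m _ => ?_
  rw [iteratedDeriv_eq_of_hasDerivAt_succ hg]
  exact fun x => (hg m x).differentiableAt

theorem IsGowdySolution_s14.exists_velocity {F : ℝ × ℝ → ℝ} (h : IsGowdySolution_s14 F) :
    ∃ V : ℕ → ℝ → ℝ, (∀ k x, HasDerivAt (V k) (V (k + 1) x) x) ∧
      (∀ x, V 0 (x + 2 * π) = V 0 x) ∧
      ∀ k, ∃ C, 0 < C ∧ ∀ x t, 0 ≤ t →
        |partialSnd (partialFst^[k] F) (x, t) - V k x| ≤ C * (1 + t) * exp (-2 * t) := by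
  choose C hC hb using fun k => (h.iterate_partialFst k).exists_partialSnd_sub_bound
  set f : ℕ → ℕ → ℝ → ℝ := fun k n x => partialSnd (partialFst^[k] F) (x, n) with hf
  have hlim0 : ∀ k, Tendsto (fun n : ℕ => C k * exp (-(n : ℝ))) atTop (𝓝 0) := fun k => by
    simpa using ((tendsto_exp_neg_atTop_nhds_zero.comp
      tendsto_natCast_atTop_atTop).const_mul (C k))
  have hle : ∀ k s, C k * (1 + s) * exp (-2 * s) ≤ C k * exp (-s) := fun k s => by
    rw [mul_assoc]
    exact mul_le_mul_of_nonneg_left (one_add_mul_exp_neg_two_mul_le s) (hC k).le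
  have hcauchy : ∀ k x, CauchySeq (fun n => f k n x) := by
    intro k x
    refine cauchySeq_of_le_tendsto_0' (fun n : ℕ => C k * exp (-(n : ℝ))) ?_ (hlim0 k)
    intro n m hnm
    rw [dist_comm, dist_eq]
    exact (hb k x n m n.cast_nonneg (by exact_mod_cast hnm)).trans (hle k n)
  choose V hV using fun k x => cauchySeq_tendsto_of_complete (hcauchy k x)
  have hbound : ∀ k x t, 0 ≤ t →
      |partialSnd (partialFst^[k] F) (x, t) - V k x| ≤ C k * (1 + t) * exp (-2 * t) := by
    intro k x t ht
    rw [abs_sub_comm]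
    refine le_of_tendsto ((hV k x).sub_const _).abs ?_
    filter_upwards [eventually_ge_atTop ⌈t⌉₊] with n hn
    exact hb k x t n ht (Nat.ceil_le.1 hn)
  refine ⟨V, fun k x => ?_, fun x => ?_, fun k => ⟨C k, hC k, hbound k⟩⟩
  · refine hasDerivAt_of_tendstoUniformly (l := atTop) (f := f k) (f' := f (k + 1)) ?_ ?_
      (hV k) x
    · rw [Metric.tendstoUniformly_iff]
      intro ε hε
      filter_upwards [(hlim0 (k + 1)).eventually (gt_mem_nhds hε)] with n hn y
      rw [dist_comm, dist_eq]
      exact ((hbound (k + 1) y n n.cast_nonneg).trans (hle _ _)).trans_lt hn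
    · refine Eventually.of_forall fun n y => ?_
      have hk := (h.iterate_partialFst k).contDiff
      have h1 := hasDerivAt_partialFst (hk.partialSnd.differentiable (by simp)) y n
      rw [partialFst_partialSnd hk] at h1
      simpa only [hf, Function.iterate_succ_apply'] using h1
  · refine tendsto_nhds_unique (hV 0 (x + 2 * π)) ?_
    have h1 : ∀ n, f 0 n (x + 2 * π) = f 0 n x := fun n =>
      partialSnd_periodic h.differentiable h.periodic x n
    simpa only [h1] using hV 0 x

/-- Polarised T³-Gowdy: if `P` is smooth, `2π`-periodic in `θ`, and satisfies
`∂_τ² P = e^{-2τ} ∂_θ² P` for `τ ≥ 0`, then there exists a smooth `2π`-periodic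
function `v : ℝ → ℝ` (the asymptotic velocity) such that for every `k ≥ 0` there is a
constant `C_k > 0` with `|∂_θ^k (∂_τ P(θ,τ) - v(θ))| ≤ C_k (1 + τ) e^{-2τ}`
for all `θ ∈ ℝ` and all `τ ≥ 0`. -/
theorem gowdy_asymptotic_velocity (P : ℝ → ℝ → ℝ)
    (hP : ContDiff ℝ (⊤ : ℕ∞) (fun p : ℝ × ℝ => P p.1 p.2))
    (hper : ∀ θ τ : ℝ, P (θ + 2 * π) τ = P θ τ)
    (heq : ∀ θ τ : ℝ, 0 ≤ τ →
      iteratedDeriv 2 (fun t => P θ t) τ =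
        Real.exp (-2 * τ) * iteratedDeriv 2 (fun s => P s τ) θ) :
    ∃ v : ℝ → ℝ, ContDiff ℝ (⊤ : ℕ∞) v ∧ (∀ θ : ℝ, v (θ + 2 * π) = v θ) ∧
      ∀ k : ℕ, ∃ C : ℝ, 0 < C ∧ ∀ θ τ : ℝ, 0 ≤ τ →
        |iteratedDeriv k (fun s => deriv (fun t => P s t) τ - v s) θ| ≤
          C * (1 + τ) * Real.exp (-2 * τ) := by
  set F : ℝ × ℝ → ℝ := fun p => P p.1 p.2 with hF
  have hd : Differentiable ℝ F := hP.differentiable (by simp)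
  have hdt : ∀ x, deriv (fun t => P x t) = fun t => partialSnd F (x, t) := fun x =>
    funext fun t => (hasDerivAt_partialSnd hd x t).deriv
  have hdx : ∀ t, deriv (fun s => P s t) = fun s => partialFst F (s, t) := fun t =>
    funext fun x => (hasDerivAt_partialFst hd x t).deriv
  have hsol : IsGowdySolution_s14 F := by
    refine ⟨hP, hper, fun x t ht => ?_⟩
    have h1 := heq x t ht
    rw [iteratedDeriv_succ, iteratedDeriv_one, iteratedDeriv_succ, iteratedDeriv_one, hdt,
      hdx, (hasDerivAt_partialSnd (hP.partialSnd.differentiable (by simp)) x t).deriv,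
      (hasDerivAt_partialFst (hP.partialFst.differentiable (by simp)) x t).deriv] at h1
    exact h1
  obtain ⟨V, hV, hVp, hVb⟩ := hsol.exists_velocity
  refine ⟨V 0, contDiff_of_hasDerivAt_succ hV, hVp, fun k => ?_⟩
  obtain ⟨C, hC, hb⟩ := hVb k
  refine ⟨C, hC, fun θ τ hτ => ?_⟩
  have h1 := iteratedDeriv_eq_of_hasDerivAt_succ
    (g := fun k x => partialSnd (partialFst^[k] F) (x, τ) - V k x)
    (fun k x => by
      have hk := (hsol.iterate_partialFst k).contDiff
      have h1 := hasDerivAt_partialFst (hk.partialSnd.differentiable (by simp)) x τ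
      rw [partialFst_partialSnd hk] at h1
      simpa only [Function.iterate_succ_apply'] using h1.fun_sub (hV k x)) k
  have h2 : (fun s => deriv (fun t => P s t) τ - V 0 s) =
      fun x => partialSnd (partialFst^[0] F) (x, τ) - V 0 x := by
    funext s
    rw [hdt]
    rfl
  rw [h2, h1]
  exact hb θ τ hτ
end
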